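/- Let X = a·∂/∂x + b·∂/∂y + c·∂/∂z be a derivation on ℂ[x,y,z] with a, b, c homogeneous polynomials of the same degree m ≥ 1, and let n ≥ 1. Assume X admits no rational first integral of degree ≤ n. If F_1, …, F_k are irreducible homogeneous polynomials in ℂ[x,y,z], pairwise non-associated (no F_i is a scalar multiple of F_j for i ≠ j), each invariant by X and each of degree at most n, then deg F_1 + ⋯ + deg F_k ≤ (m(n⁴+6n³+11n²+6n) − n⁴ − 2n³ + n² + 2n)/8. -/

import Mathlib

open MvPolynomial

/-- `D` admits a rational first integral of degree `e`: there are `ℂ`-linearly independent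
homogeneous polynomials `F`, `G` of degree `e` with `G·D(F) = F·D(G)`. -/
def HasRatFirstIntegral
    (D : Derivation ℂ (MvPolynomial (Fin 3) ℂ) (MvPolynomial (Fin 3) ℂ)) (e : ℕ) : Prop :=
  ∃ F G : MvPolynomial (Fin 3) ℂ, F.IsHomogeneous e ∧ G.IsHomogeneous e ∧
    LinearIndependent ℂ ![F, G] ∧ G * D F = F * D G

section Elimination

open Polynomial in
lemma exists_clear_denominators {A : Type*} [CommRing A] [IsDomain A] (a : (FractionRing A)[X]) :
    ∃ d : A, d ≠ 0 ∧ ∃ a' : A[X], a'.map (algebraMap A (FractionRing A)) =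
      Polynomial.C (algebraMap A (FractionRing A) d) * a := by
  obtain ⟨b, hb, h⟩ := IsLocalization.integerNormalization_spec (nonZeroDivisors A) a
  refine ⟨b, nonZeroDivisors.ne_zero hb, _, h.trans ?_⟩
  rw [Algebra.smul_def]
  rfl

open Polynomial in
/-- An irreducible polynomial of positive degree over a UFD and a polynomial it does not divide
generate an ideal containing a nonzero constant. -/
lemma exists_bezout_of_irreducible {A : Type*} [CommRing A] [IsDomain A]
    [UniqueFactorizationMonoid A] {z w : A[X]} (hz : Irreducible z) (hd : z.natDegree ≠ 0)
    (h : ¬ z ∣ w) : ∃ (a b : A[X]) (r : A), r ≠ 0 ∧ a * z + b * w = Polynomial.C r := by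
  have hf : Function.Injective (algebraMap A (FractionRing A)) := IsFractionRing.injective A _
  have hz' : Irreducible (z.map (algebraMap A (FractionRing A))) :=
    ((hz.isPrimitive hd).irreducible_iff_irreducible_map_fraction_map).1 hz
  have h' : ¬ z.map (algebraMap A (FractionRing A)) ∣ w.map (algebraMap A (FractionRing A)) := by
    rintro ⟨q, hq⟩
    obtain ⟨d, hd0, q', hq'⟩ := exists_clear_denominators q
    have : Polynomial.C d * w = z * q' := by
      apply Polynomial.map_injective _ hf
      rw [Polynomial.map_mul, Polynomial.map_mul, hq', hq, Polynomial.map_C]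
      ring
    rcases hz.prime.dvd_or_dvd ⟨q', this⟩ with h1 | h1
    · have := Polynomial.natDegree_le_of_dvd h1 (by simpa using hd0)
      simp only [Polynomial.natDegree_C, nonpos_iff_eq_zero] at this
      exact hd this
    · exact h h1
  obtain ⟨a, b, hab⟩ := (hz'.coprime_iff_not_dvd).2 h'
  obtain ⟨d, hd0, a', ha'⟩ := exists_clear_denominators a
  obtain ⟨e, he0, b', hb'⟩ := exists_clear_denominators b
  refine ⟨Polynomial.C e * a', Polynomial.C d * b', d * e, mul_ne_zero hd0 he0, ?_⟩
  apply Polynomial.map_injective _ hf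
  simp only [Polynomial.map_add, Polynomial.map_mul, ha', hb', Polynomial.map_C, map_mul]
  linear_combination (Polynomial.C (algebraMap A (FractionRing A) d) *
    Polynomial.C (algebraMap A (FractionRing A) e)) * hab

/-- Elimination of the variable `i` from an irreducible polynomial and a polynomial it does not
divide. -/
lemma exists_mul_add_mul_pderiv_eq_zero {R σ : Type*} [CommRing R] [IsDomain R]
    [UniqueFactorizationMonoid R] [DecidableEq σ]
    {z w : MvPolynomial σ R} (hz : Irreducible z) (i : σ) (hi : pderiv i z ≠ 0)
    (h : ¬ z ∣ w) : ∃ a b : MvPolynomial σ R, a * z + b * w ≠ 0 ∧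
      pderiv i (a * z + b * w) = 0 := by
  let e : MvPolynomial σ R ≃ₐ[R] Polynomial (MvPolynomial {j : σ // j ≠ i} R) :=
    (renameEquiv R (Equiv.optionSubtypeNe i).symm).trans (optionEquivLeft R _)
  have hC : ∀ r, pderiv i (e.symm (Polynomial.C r)) = 0 := by
    intro r
    have : e.symm (Polynomial.C r) = rename Subtype.val r := by
      rw [AlgEquiv.symm_apply_eq]
      induction r using MvPolynomial.induction_on with
      | C a => simp [e]
      | add p q hp hq => simp only [map_add, hp, hq]
      | mul_X p j hp =>
        simp only [map_mul, hp]
        simp [e, j.2]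
    rw [this]
    clear this
    induction r using MvPolynomial.induction_on with
    | C a => simp
    | add p q hp hq => simp [hp, hq]
    | mul_X p j hp => simp [hp, pderiv_X_of_ne j.2]
  obtain ⟨a, b, r, hr, hab⟩ := exists_bezout_of_irreducible (z := e z) (w := e w)
    ((MulEquiv.irreducible_iff e).2 hz) (fun h0 => hi (by
      rw [← e.symm_apply_apply z, Polynomial.eq_C_of_natDegree_eq_zero h0, hC]))
    (fun h0 => h ((map_dvd_iff e).1 h0))
  have : e.symm a * z + e.symm b * w = e.symm (Polynomial.C r) := by
    rw [AlgEquiv.eq_symm_apply]; simpa using hab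
  refine ⟨e.symm a, e.symm b, ?_, ?_⟩
  · rw [this]; simpa using hr
  · rw [this, hC]

end Elimination

section StableIdeal

variable {R A : Type*} [CommRing R] [CommRing A] [Algebra R A]

lemma Derivation.iterate_mul (D : Derivation R A A) (n : ℕ) (f g : A) :
    D^[n] (f * g) = ∑ ij ∈ Finset.HasAntidiagonal.antidiagonal n,
      (n.choose ij.1 : A) * (D^[ij.1] f * D^[ij.2] g) := by
  induction n with
  | zero => simp
  | succ n ih =>
    rw [Function.iterate_succ_apply', ih,
      Finset.sum_antidiagonal_choose_succ_mul (fun i j => D^[i] f * D^[j] g), map_sum,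
      ← Finset.sum_add_distrib]
    refine Finset.sum_congr rfl fun ij hij => ?_
    have : n.choose ij.2 = n.choose ij.1 := by
      rw [← Finset.HasAntidiagonal.mem_antidiagonal.1 hij]; exact Nat.choose_symm_add.symm
    simp only [Derivation.leibniz, Derivation.map_natCast, smul_eq_mul, this,
      Function.iterate_succ_apply']
    ring

/-- The largest ideal contained in `I` and stable under the derivation `D`. -/
def stableIdeal (D : Derivation R A A) (I : Ideal A) : Ideal A where
  carrier := {f | ∀ i : ℕ, D^[i] f ∈ I}
  zero_mem' i := by simp [iterate_map_zero]
  add_mem' hf hg i := by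
    rw [iterate_map_add]
    exact I.add_mem (hf i) (hg i)
  smul_mem' a f hf i := by
    rw [smul_eq_mul, D.iterate_mul]
    exact I.sum_mem fun ij _ => I.mul_mem_left _ (I.mul_mem_left _ (hf _))

lemma mem_stableIdeal {D : Derivation R A A} {I : Ideal A} {f : A} :
    f ∈ stableIdeal D I ↔ ∀ i : ℕ, D^[i] f ∈ I := Iff.rfl

lemma apply_mem_stableIdeal {D : Derivation R A A} {I : Ideal A} {f : A}
    (hf : f ∈ stableIdeal D I) : D f ∈ stableIdeal D I := fun i => hf (i + 1)

lemma stableIdeal_isPrime [Algebra ℚ A] (D : Derivation R A A) {I : Ideal A} (hI : I.IsPrime) :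
    (stableIdeal D I).IsPrime := by
  classical
  refine ⟨fun h => hI.ne_top ?_, ?_⟩
  · rw [Ideal.eq_top_iff_one] at h ⊢
    exact h 0
  intro f g hfg
  by_contra! hcon
  simp only [mem_stableIdeal, not_forall] at hcon
  obtain ⟨hf, hg⟩ := hcon
  have key := hfg (Nat.find hf + Nat.find hg)
  rw [D.iterate_mul, ← Finset.add_sum_erase _ _
    (Finset.HasAntidiagonal.mem_antidiagonal.2 rfl : (Nat.find hf, Nat.find hg) ∈ _)] at key
  rw [I.add_mem_iff_left] at key
  · rcases hI.mem_or_mem key with h | h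
    · have hne : (((Nat.find hf + Nat.find hg).choose (Nat.find hf) : ℕ) : ℚ) ≠ 0 :=
        Nat.cast_ne_zero.2 (Nat.choose_pos (Nat.le_add_right _ _)).ne'
      have hu := (hne.isUnit).map (algebraMap ℚ A)
      rw [map_natCast] at hu
      exact hI.ne_top (Ideal.eq_top_of_isUnit_mem _ h hu)
    · rcases hI.mem_or_mem h with h | h
      · exact Nat.find_spec hf h
      · exact Nat.find_spec hg h
  · refine I.sum_mem fun ij hij => I.mul_mem_left _ ?_
    obtain ⟨hne, hs⟩ := Finset.mem_erase.1 hij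
    have hs := Finset.HasAntidiagonal.mem_antidiagonal.1 hs
    rcases lt_or_ge ij.1 (Nat.find hf) with h1 | h1
    · exact I.mul_mem_right _ (not_not.1 (Nat.find_min hf h1))
    · have h2 : ij.2 < Nat.find hg := by
        by_contra h2
        exact hne (Prod.ext (by simp only; omega) (by simp only; omega))
      exact I.mul_mem_left _ (not_not.1 (Nat.find_min hg h2))

end StableIdeal

section Wronskian

/-- If the vectors `D^i v`, `i < N`, are linearly dependent, then a vector orthogonal to
all of them is orthogonal to every `D^i v`. -/
lemma exists_forall_sum_iterate_eq_zero {R A : Type*} [CommRing R] [CommRing A] [IsDomain A]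
    [Algebra R A] (D : Derivation R A A) {N : ℕ} (v : Fin N → A)
    (h : (Matrix.of fun i j : Fin N => D^[(i : ℕ)] (v j)).det = 0) :
    ∃ c : Fin N → A, c ≠ 0 ∧ ∀ i : ℕ, ∑ j, c j * D^[i] (v j) = 0 := by
  classical
  obtain ⟨c, hc0, hc⟩ := Matrix.exists_mulVec_eq_zero_iff.2 h
  obtain ⟨s, hs0, hs⟩ := Matrix.exists_vecMul_eq_zero_iff.2 h
  obtain ⟨r, hr, hmax⟩ : ∃ r : Fin N, s r ≠ 0 ∧ ∀ i, r < i → s i = 0 := by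
    have hne : (Finset.univ.filter fun i => s i ≠ 0).Nonempty := by
      obtain ⟨i, hi⟩ := Function.ne_iff.1 hs0
      exact ⟨i, by simpa using hi⟩
    refine ⟨_, (Finset.mem_filter.1 (Finset.max'_mem _ hne)).2, fun i hi => ?_⟩
    by_contra hsi
    exact (Finset.le_max' _ i (by simpa using hsi)).not_gt hi
  have hstep : ∀ c : Fin N → A, (∀ i : ℕ, i < r → ∑ j, c j * D^[i] (v j) = 0) →
      ∑ j, c j * D^[(r : ℕ)] (v j) = 0 := by
    intro c hc
    have h1 : ∑ i, s i * ∑ j, c j * D^[(i : ℕ)] (v j) = 0 := by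
      simp_rw [Finset.mul_sum]
      rw [Finset.sum_comm]
      refine Finset.sum_eq_zero fun j _ => ?_
      have := congrFun hs j
      simp only [Matrix.vecMul, dotProduct, Matrix.of_apply, Pi.zero_apply] at this
      calc _ = c j * ∑ i, s i * D^[(i : ℕ)] (v j) := by
            rw [Finset.mul_sum]; exact Finset.sum_congr rfl fun i _ => by ring
        _ = 0 := by rw [this, mul_zero]
    rw [Finset.sum_eq_single r] at h1
    · exact (mul_eq_zero.1 h1).resolve_left hr
    · intro i _ hi
      rcases lt_or_gt_of_ne hi with h2 | h2
      · rw [hc i h2, mul_zero]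
      · rw [hmax i h2, zero_mul]
    · simp
  have hall : ∀ (i : ℕ) (c : Fin N → A), (∀ i : ℕ, i < r → ∑ j, c j * D^[i] (v j) = 0) →
      ∑ j, c j * D^[i] (v j) = 0 := by
    have hD : ∀ (i : ℕ) (c : Fin N → A), D (∑ j, c j * D^[i] (v j)) =
        ∑ j, c j * D^[i + 1] (v j) + ∑ j, D (c j) * D^[i] (v j) := by
      intro i c
      rw [map_sum, ← Finset.sum_add_distrib]
      refine Finset.sum_congr rfl fun j _ => ?_
      rw [Derivation.leibniz, Function.iterate_succ_apply', smul_eq_mul, smul_eq_mul,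
        mul_comm (D^[i] (v j))]
    intro i
    induction i with
    | zero =>
      intro c hc
      rcases Nat.eq_zero_or_pos (r : ℕ) with h0 | h0
      · simpa [h0] using hstep c hc
      · exact hc 0 h0
    | succ i ih =>
      intro c hc
      have h1 := hD i c
      rw [ih c hc, map_zero, ih (fun j => D (c j)), add_zero] at h1
      · exact h1.symm
      intro k hk
      have h2 := hD k c
      rw [hc k hk, map_zero] at h2
      rcases Nat.lt_or_ge (k + 1) r with h3 | h3
      · rw [hc _ h3, zero_add] at h2
        exact h2.symm
      · rw [show k + 1 = r by omega, hstep c hc, zero_add] at h2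
        exact h2.symm
  refine ⟨c, hc0, fun i => hall i c fun k hk => ?_⟩
  have := congrFun hc ⟨k, hk.trans r.2⟩
  simp only [Matrix.mulVec, dotProduct, Matrix.of_apply, Pi.zero_apply] at this
  rw [← this]
  exact Finset.sum_congr rfl fun j _ => mul_comm _ _

end Wronskian

section Polynomials

variable {σ R : Type*} [CommRing R]

lemma derivation_eq_sum_pderiv [Fintype σ]
    (D : Derivation R (MvPolynomial σ R) (MvPolynomial σ R)) (f : MvPolynomial σ R) :
    D f = ∑ l, pderiv l f * D (X l) := by
  classical
  have hsum (g : MvPolynomial σ R) :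
      (∑ l, D (X l) • pderiv l) g = ∑ l, (D (X l) • pderiv l) g := by
    change Derivation.coeFnAddMonoidHom _ g = _
    rw [map_sum, Finset.sum_apply]
    rfl
  have : D = ∑ l, D (X l) • pderiv l := by
    refine derivation_ext fun i => ?_
    rw [hsum, Finset.sum_eq_single i]
    · simp
    · intro l _ hl
      simp [pderiv_X_of_ne hl.symm]
    · simp
  conv_lhs => rw [this]
  rw [hsum]
  exact Finset.sum_congr rfl fun l _ => by
    rw [Derivation.smul_apply, smul_eq_mul, mul_comm]

/-- The Euler derivation `∑ xᵢ ∂/∂xᵢ`. -/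
noncomputable def eulerDerivation (σ R : Type*) [CommRing R] :
    Derivation R (MvPolynomial σ R) (MvPolynomial σ R) := mkDerivation R X

lemma eulerDerivation_of_isHomogeneous [Fintype σ] {f : MvPolynomial σ R} {n : ℕ}
    (hf : f.IsHomogeneous n) : eulerDerivation σ R f = n • f := by
  rw [← hf.sum_X_mul_pderiv, derivation_eq_sum_pderiv]
  exact Finset.sum_congr rfl fun i _ => by rw [eulerDerivation, mkDerivation_X, mul_comm]

lemma coeff_eulerDerivation [Fintype σ] (f : MvPolynomial σ R) (a : σ →₀ ℕ) :
    coeff a (eulerDerivation σ R f) = a.degree * coeff a f := by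
  classical
  induction f using MvPolynomial.induction_on' with
  | monomial s r =>
    rw [eulerDerivation_of_isHomogeneous (isHomogeneous_monomial r rfl), coeff_smul,
      coeff_monomial, nsmul_eq_mul]
    split_ifs with h
    · rw [h]
    · simp
  | add p q hp hq => rw [map_add, coeff_add, coeff_add, hp, hq, mul_add]

lemma exists_eq_C_of_totalDegree_le [IsDomain R] {f g q : MvPolynomial σ R} (hf : f ≠ 0)
    (h : g = f * q) (hg : g.totalDegree ≤ f.totalDegree) : ∃ s, q = C s := by
  by_cases hq : q = 0
  · exact ⟨0, by simp [hq]⟩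
  · rw [h, totalDegree_mul_of_isDomain hf hq] at hg
    exact ⟨_, totalDegree_eq_zero_iff_eq_C.1 (by omega)⟩

lemma exists_isHomogeneous_of_dvd_eulerDerivation [Fintype σ] [IsDomain R] [CharZero R]
    {f : MvPolynomial σ R} (hf : f ≠ 0) (h : f ∣ eulerDerivation σ R f) :
    ∃ e, f.IsHomogeneous e := by
  obtain ⟨q, hq⟩ := h
  obtain ⟨s, rfl⟩ := exists_eq_C_of_totalDegree_le hf hq
    (totalDegree_le_of_support_subset fun a ha => by
      rw [mem_support_iff, coeff_eulerDerivation] at ha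
      exact mem_support_iff.2 (right_ne_zero_of_mul ha))
  have key : ∀ a, coeff a f ≠ 0 → (a.degree : R) = s := by
    intro a ha
    have := congrArg (coeff a) hq
    rw [coeff_eulerDerivation, mul_comm f, coeff_C_mul, mul_comm, mul_comm s] at this
    exact mul_left_cancel₀ ha this
  obtain ⟨a₀, h₀⟩ := ne_zero_iff.1 hf
  refine ⟨a₀.degree, fun a ha => ?_⟩
  have : (a.degree : R) = a₀.degree := (key a ha).trans (key a₀ h₀).symm
  have hw : Finsupp.weight 1 a = a.degree :=
    (DFunLike.congr_fun Finsupp.degree_eq_weight_one a).symm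
  rw [hw]
  exact_mod_cast this

lemma totalDegree_pderiv_le (i : σ) (f : MvPolynomial σ R) :
    (pderiv i f).totalDegree ≤ f.totalDegree - 1 := by
  refine Finset.sup_le fun a ha => ?_
  rw [mem_support_iff, coeff_pderiv] at ha
  have := le_totalDegree (mem_support_iff.2 (left_ne_zero_of_mul ha))
  rw [Finsupp.sum_add_index' (fun _ => rfl) (fun _ _ _ => rfl),
    Finsupp.sum_single_index rfl] at this
  omega

lemma pderiv_pderiv_eq_zero [IsDomain R] [CharZero R] {f : MvPolynomial σ R} {i : σ}
    (h : pderiv i f = 0) (l : σ) : pderiv i (pderiv l f) = 0 := by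
  classical
  ext a
  have h1 := congrArg (coeff (a + Finsupp.single l 1)) h
  rw [coeff_pderiv, coeff_zero, mul_eq_zero] at h1
  rw [coeff_pderiv, coeff_pderiv, add_right_comm, coeff_zero,
    h1.resolve_right (Nat.cast_add_one_ne_zero _), zero_mul, zero_mul]

lemma exists_eq_C_of_pderiv_eq_zero [IsDomain R] [CharZero R] {f : MvPolynomial σ R}
    (h : ∀ i, pderiv i f = 0) : ∃ s, f = C s := by
  classical
  refine ⟨coeff 0 f, ?_⟩
  ext a
  rw [coeff_C]
  split_ifs with ha
  · rw [ha]
  · obtain ⟨i, hi⟩ := Finsupp.ne_iff.1 (Ne.symm ha)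
    rw [Finsupp.coe_zero, Pi.zero_apply] at hi
    have h1 := congrArg (coeff (a - Finsupp.single i 1)) (h i)
    rw [coeff_pderiv, tsub_add_cancel_of_le (Finsupp.single_le_iff.2 (by omega)), coeff_zero,
      mul_eq_zero] at h1
    exact h1.resolve_right (Nat.cast_add_one_ne_zero _)

/-- In three variables, a prime ideal stable under the Euler derivation and another derivation
`D` not proportional to it modulo the ideal contains no nonzero polynomial in two variables. -/
lemma eq_zero_of_mem_of_pderiv_eq_zero [IsDomain R] [CharZero R]
    (D : Derivation R (MvPolynomial (Fin 3) R) (MvPolynomial (Fin 3) R))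
    {J : Ideal (MvPolynomial (Fin 3) R)} (hJ : J.IsPrime) (hD : ∀ f ∈ J, D f ∈ J)
    (hE : ∀ f ∈ J, eulerDerivation _ _ f ∈ J) (hC : ∀ s, C s ∈ J → s = 0)
    (hind : ∀ j k, j ≠ k → X j * D (X k) - X k * D (X j) ∉ J) (i : Fin 3)
    {r : MvPolynomial (Fin 3) R} (hr : r ∈ J) (hir : pderiv i r = 0) : r = 0 := by
  obtain ⟨j, k, hjk, hall, hsum⟩ : ∃ j k : Fin 3, j ≠ k ∧ (∀ l, l = i ∨ l = j ∨ l = k) ∧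
      ∀ f : Fin 3 → MvPolynomial (Fin 3) R, ∑ l, f l = f i + f j + f k := by
    fin_cases i
    · exact ⟨1, 2, by decide, by decide, fun f => by simp [Fin.sum_univ_three]⟩
    · exact ⟨0, 2, by decide, by decide, fun f => by simp [Fin.sum_univ_three]; ring⟩
    · exact ⟨0, 1, by decide, by decide, fun f => by simp [Fin.sum_univ_three]; ring⟩
  induction hn : r.totalDegree using Nat.strong_induction_on generalizing r with
  | _ n ih =>
    rcases Nat.eq_zero_or_pos n with h0 | h0
    · rw [totalDegree_eq_zero_iff_eq_C.1 (hn.trans h0)] at hr ⊢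
      rw [hC _ hr, C_0]
    have h1 := hD r hr
    have h2 := hE r hr
    rw [derivation_eq_sum_pderiv, hsum, hir, zero_mul, zero_add] at h1 h2
    simp only [eulerDerivation, mkDerivation_X] at h2
    have h3 : pderiv k r * (X j * D (X k) - X k * D (X j)) ∈ J := by
      convert J.sub_mem (J.mul_mem_left (X j) h1) (J.mul_mem_left (D (X j)) h2) using 1
      ring
    have h4 : pderiv j r * (X k * D (X j) - X j * D (X k)) ∈ J := by
      convert J.sub_mem (J.mul_mem_left (X k) h1) (J.mul_mem_left (D (X k)) h2) using 1
      ring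
    have hzero : ∀ l, pderiv l r ∈ J → pderiv l r = 0 := fun l hl => by
      have hlt : (pderiv l r).totalDegree < n :=
        (totalDegree_pderiv_le l r).trans_lt (by omega)
      exact ih _ hlt hl (pderiv_pderiv_eq_zero hir l) rfl
    have hk := hzero k ((hJ.mem_or_mem h3).resolve_right (hind j k hjk))
    have hj := hzero j ((hJ.mem_or_mem h4).resolve_right (hind k j hjk.symm))
    obtain ⟨s, rfl⟩ := exists_eq_C_of_pderiv_eq_zero (f := r) fun l => by
      rcases hall l with rfl | rfl | rfl <;> assumption
    rw [hC _ hr, C_0]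

/-- In three variables, a prime ideal stable under the Euler derivation and another derivation
`D` not proportional to it modulo the ideal is generated by each prime element it contains. -/
lemma dvd_of_prime_of_mem [IsDomain R] [CharZero R] [UniqueFactorizationMonoid R]
    (D : Derivation R (MvPolynomial (Fin 3) R) (MvPolynomial (Fin 3) R))
    {J : Ideal (MvPolynomial (Fin 3) R)} (hJ : J.IsPrime) (hD : ∀ f ∈ J, D f ∈ J)
    (hE : ∀ f ∈ J, eulerDerivation _ _ f ∈ J) (hC : ∀ s, C s ∈ J → s = 0)
    (hind : ∀ j k, j ≠ k → X j * D (X k) - X k * D (X j) ∉ J)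
    {z w : MvPolynomial (Fin 3) R} (hz : Prime z) (hzJ : z ∈ J) (hw : w ∈ J) : z ∣ w := by
  by_contra hdvd
  obtain ⟨i, hi⟩ : ∃ i, pderiv i z ≠ 0 := by
    by_contra! hcon
    obtain ⟨s, rfl⟩ := exists_eq_C_of_pderiv_eq_zero hcon
    exact hz.ne_zero (by rw [hC s hzJ, C_0])
  obtain ⟨a, b, hne, h0⟩ := exists_mul_add_mul_pderiv_eq_zero hz.irreducible i hi hdvd
  exact hne (eq_zero_of_mem_of_pderiv_eq_zero D hJ hD hE hC hind i
    (J.add_mem (J.mul_mem_left a hzJ) (J.mul_mem_left b hw)) h0)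

end Polynomials

section Doubling

variable {σ R : Type*} [CommRing R]

/-- The extension of a derivation to a second set of variables, linear over polynomials
in the original variables. -/
noncomputable def doubleDerivation (D : Derivation R (MvPolynomial σ R) (MvPolynomial σ R)) :
    Derivation (MvPolynomial σ R) (MvPolynomial σ (MvPolynomial σ R))
      (MvPolynomial σ (MvPolynomial σ R)) :=
  mkDerivation _ fun i => map C (D (X i))

variable (D : Derivation R (MvPolynomial σ R) (MvPolynomial σ R))

lemma doubleDerivation_map_C (f : MvPolynomial σ R) :
    doubleDerivation D (map C f) = map C (D f) := by
  induction f using MvPolynomial.induction_on with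
  | C a => simp
  | add p q hp hq => simp only [map_add, hp, hq]
  | mul_X p i hp =>
    rw [map_mul, map_X, Derivation.leibniz, hp, Derivation.leibniz, doubleDerivation,
      mkDerivation_X]
    simp

lemma doubleDerivation_C_mul_map_C (s f : MvPolynomial σ R) :
    doubleDerivation D (C s * map C f) = C s * map C (D f) := by
  rw [Derivation.leibniz, derivation_C, smul_zero, add_zero, doubleDerivation_map_C, smul_eq_mul]

lemma eval_X_map_C (f : MvPolynomial σ R) : eval X (map C f) = f := by
  rw [eval_map, eval₂_eta]

lemma eulerDerivation_doubleDerivation [Fintype σ] {m : ℕ} (h : ∀ i, (D (X i)).IsHomogeneous m)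
    (f : MvPolynomial σ (MvPolynomial σ R)) :
    eulerDerivation _ _ (doubleDerivation D f) =
      doubleDerivation D (eulerDerivation _ _ f) + ((m : ℤ) - 1) • doubleDerivation D f := by
  have : ⁅eulerDerivation σ (MvPolynomial σ R), doubleDerivation D⁆ =
      ((m : ℤ) - 1) • doubleDerivation D := by
    refine derivation_ext fun i => ?_
    rw [Derivation.commutator_apply, Derivation.smul_apply]
    have hi : (doubleDerivation D (X i)).IsHomogeneous m := by
      rw [doubleDerivation, mkDerivation_X]; exact (h i).map _
    rw [eulerDerivation_of_isHomogeneous hi, eulerDerivation, mkDerivation_X, sub_smul, one_smul,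
      natCast_zsmul]
  have h1 := DFunLike.congr_fun this f
  rw [Derivation.commutator_apply, Derivation.smul_apply, sub_eq_iff_eq_add'] at h1
  exact h1

/-- The polynomials vanishing on the diagonal together with all their iterated derivatives
along `D` and the Euler derivation. -/
noncomputable def contactIdeal : Ideal (MvPolynomial σ (MvPolynomial σ R)) :=
  stableIdeal (eulerDerivation σ (MvPolynomial σ R))
    (stableIdeal (doubleDerivation D) (RingHom.ker (eval X)))

lemma contactIdeal_isPrime [Algebra ℚ R] [IsDomain R] : (contactIdeal D).IsPrime :=
  stableIdeal_isPrime _ (stableIdeal_isPrime _ (RingHom.ker_isPrime _))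

variable {D}

lemma eval_X_eq_zero_of_mem_contactIdeal {f : MvPolynomial σ (MvPolynomial σ R)}
    (hf : f ∈ contactIdeal D) : eval X f = 0 := hf 0 0

lemma eulerDerivation_mem_contactIdeal {f : MvPolynomial σ (MvPolynomial σ R)}
    (hf : f ∈ contactIdeal D) : eulerDerivation _ _ f ∈ contactIdeal D :=
  apply_mem_stableIdeal hf

lemma doubleDerivation_mem_contactIdeal [Fintype σ] {m : ℕ} (h : ∀ i, (D (X i)).IsHomogeneous m)
    {f : MvPolynomial σ (MvPolynomial σ R)} (hf : f ∈ contactIdeal D) :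
    doubleDerivation D f ∈ contactIdeal D := by
  intro i
  induction i generalizing f with
  | zero => exact apply_mem_stableIdeal (hf 0)
  | succ i ih =>
    rw [Function.iterate_succ_apply, eulerDerivation_doubleDerivation D h, iterate_map_add,
      iterate_map_zsmul]
    exact add_mem (ih (eulerDerivation_mem_contactIdeal hf)) (zsmul_mem (ih hf) _)

lemma mem_contactIdeal_of_isHomogeneous [Fintype σ] {n : ℕ}
    {f : MvPolynomial σ (MvPolynomial σ R)} (hf : f.IsHomogeneous n)
    (h : ∀ i : ℕ, eval X ((doubleDerivation D)^[i] f) = 0) : f ∈ contactIdeal D := by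
  intro k
  have hk : (eulerDerivation σ (MvPolynomial σ R))^[k] f = n ^ k • f := by
    induction k with
    | zero => simp
    | succ k ih =>
      rw [Function.iterate_succ_apply', ih, map_nsmul, eulerDerivation_of_isHomogeneous hf,
        smul_smul, pow_succ]
  rw [hk]
  exact nsmul_mem (show f ∈ stableIdeal (doubleDerivation D) (RingHom.ker (eval X)) from h) _

lemma commAlgEquiv_map_C (f : MvPolynomial σ R) :
    commAlgEquiv R σ σ (map C f) = C f := by
  induction f using MvPolynomial.induction_on with
  | C a => rw [map_C, commAlgEquiv_C, map_C]
  | add p q hp hq => simp only [map_add, hp, hq]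
  | mul_X p i hp => rw [map_mul, map_mul, hp, map_X, commAlgEquiv_X, C_mul]

lemma coeff_commAlgEquiv_C_mul_map_C (s f : MvPolynomial σ R) (j : σ →₀ ℕ) :
    coeff j (commAlgEquiv R σ σ (C s * map C f)) = C (coeff j s) * f := by
  rw [map_mul, commAlgEquiv_C, commAlgEquiv_map_C, mul_comm, coeff_C_mul, coeff_map, mul_comm]

lemma monomial_eq_C_mul_map_C (a : σ →₀ ℕ) (s : MvPolynomial σ R) :
    (monomial a s : MvPolynomial σ (MvPolynomial σ R)) = C s * map C (monomial a 1) := by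
  rw [map_monomial, C_1, C_mul_monomial, mul_one]

lemma coeff_commAlgEquiv_doubleDerivation (f : MvPolynomial σ (MvPolynomial σ R)) (j : σ →₀ ℕ) :
    coeff j (commAlgEquiv R σ σ (doubleDerivation D f)) =
      D (coeff j (commAlgEquiv R σ σ f)) := by
  induction f using MvPolynomial.induction_on' with
  | monomial a s =>
    rw [monomial_eq_C_mul_map_C, doubleDerivation_C_mul_map_C, coeff_commAlgEquiv_C_mul_map_C,
      coeff_commAlgEquiv_C_mul_map_C, Derivation.leibniz, derivation_C, smul_zero, add_zero,
      smul_eq_mul]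
  | add p q hp hq => simp only [map_add, coeff_add, hp, hq]

lemma coeff_coeff_commAlgEquiv (f : MvPolynomial σ (MvPolynomial σ R)) (j a : σ →₀ ℕ) :
    coeff a (coeff j (commAlgEquiv R σ σ f)) = coeff j (coeff a f) := by
  classical
  induction f using MvPolynomial.induction_on' with
  | monomial b s =>
    rw [coeff_monomial, monomial_eq_C_mul_map_C, coeff_commAlgEquiv_C_mul_map_C, coeff_C_mul,
      coeff_monomial]
    split_ifs <;> simp
  | add p q hp hq => simp only [map_add, coeff_add, hp, hq]

end Doubling

/-- If `z` vanishes on the diagonal and is an eigenvector of the doubled derivation, then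
its coefficients with respect to the first set of variables yield a rational first integral. -/
lemma hasRatFirstIntegral_of_dvd
    {D : Derivation ℂ (MvPolynomial (Fin 3) ℂ) (MvPolynomial (Fin 3) ℂ)}
    {z : MvPolynomial (Fin 3) (MvPolynomial (Fin 3) ℂ)} {e : ℕ} (hz : z ≠ 0)
    (hdiag : eval X z = 0) (hhom : z.IsHomogeneous e) (hdvd : z ∣ doubleDerivation D z) :
    HasRatFirstIntegral D e := by
  classical
  set y := commAlgEquiv ℂ (Fin 3) (Fin 3) z with hy
  have hy0 : y ≠ 0 := by simpa [hy] using hz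
  have hyhom (j) : (coeff j y).IsHomogeneous e := fun a ha => hhom fun h0 => ha (by
    rw [coeff_coeff_commAlgEquiv, h0, coeff_zero])
  obtain ⟨q, hq⟩ := hdvd
  have hq' := congrArg (commAlgEquiv ℂ (Fin 3) (Fin 3)) hq
  rw [map_mul, ← hy] at hq'
  obtain ⟨L, hL⟩ := exists_eq_C_of_totalDegree_le hy0 hq'
    (totalDegree_le_of_support_subset fun j hj => by
      rw [mem_support_iff, coeff_commAlgEquiv_doubleDerivation] at hj
      exact mem_support_iff.2 fun h0 => hj (by rw [← hy, h0, map_zero]))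
  have hcof (j) : D (coeff j y) = L * coeff j y := by
    rw [hy, ← coeff_commAlgEquiv_doubleDerivation, hq', hL, mul_comm, coeff_C_mul]
  obtain ⟨j₀, hj₀⟩ := ne_zero_iff.1 hy0
  by_cases hex : ∃ j, LinearIndependent ℂ ![coeff j₀ y, coeff j y]
  · obtain ⟨j, hj⟩ := hex
    exact ⟨_, _, hyhom j₀, hyhom j, hj, by rw [hcof, hcof]; ring⟩
  · exfalso
    push Not at hex
    have hex' (j) : ∃ a : ℂ, a • coeff j₀ y = coeff j y := by
      have := hex j
      rw [LinearIndependent.pair_iff' hj₀] at this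
      push Not at this
      exact this
    choose a ha using hex'
    set f : MvPolynomial (Fin 3) ℂ := ∑ j ∈ y.support, monomial j (a j) with hf
    have hcf (j) : coeff j y = coeff j₀ y * C (coeff j f) := by
      rw [hf, coeff_sum]
      simp only [coeff_monomial, Finset.sum_ite_eq']
      split_ifs with hj
      · rw [mul_comm, ← smul_eq_C_mul, ha]
      · rw [notMem_support_iff.1 hj, C_0, mul_zero]
    have hyf : y = C (coeff j₀ y) * map C f := by
      ext1 j
      rw [coeff_C_mul, coeff_map, ← hcf]
    have hzf : z = map C (coeff j₀ y) * C f := by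
      apply (commAlgEquiv ℂ (Fin 3) (Fin 3)).injective
      rw [map_mul, commAlgEquiv_map_C, commAlgEquiv_C, ← hyf]
    rw [hzf, map_mul, eval_X_map_C, eval_C] at hdiag
    rcases mul_eq_zero.1 hdiag with h | h
    · exact hj₀ h
    · exact hy0 (by rw [hyf, h, map_zero, mul_zero])

/-- Vanishing of the extactic determinant yields a rational first integral of degree at
most `n`. -/
lemma exists_hasRatFirstIntegral_of_det_eq_zero
    (D : Derivation ℂ (MvPolynomial (Fin 3) ℂ) (MvPolynomial (Fin 3) ℂ)) {m : ℕ}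
    (hhom : ∀ i : Fin 3, (D (X i)).IsHomogeneous m) {n N : ℕ} (hn : 1 ≤ n)
    (mon : Fin N → (Fin 3 →₀ ℕ)) (hinj : Function.Injective mon) (hmon : ∀ i, (mon i).degree = n)
    (h : (Matrix.of fun i j : Fin N => D^[(i : ℕ)] (monomial (mon j) 1)).det = 0) :
    ∃ e, 1 ≤ e ∧ e ≤ n ∧ HasRatFirstIntegral D e := by
  classical
  by_cases h1 : HasRatFirstIntegral D 1
  · exact ⟨1, le_rfl, hn, h1⟩
  obtain ⟨c, hc0, hc⟩ := exists_forall_sum_iterate_eq_zero D _ h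
  set P : MvPolynomial (Fin 3) (MvPolynomial (Fin 3) ℂ) := ∑ j, monomial (mon j) (c j) with hP
  have hPhom : P.IsHomogeneous n :=
    IsHomogeneous.sum _ _ _ fun j _ => isHomogeneous_monomial _ (hmon j)
  have hP0 : P ≠ 0 := by
    obtain ⟨j, hj⟩ := Function.ne_iff.1 hc0
    refine ne_zero_iff.2 ⟨mon j, ?_⟩
    rw [hP, coeff_sum, Finset.sum_eq_single j]
    · simpa using hj
    · intro k _ hk
      rw [coeff_monomial, if_neg (hinj.ne hk)]
    · simp
  have hPit (i : ℕ) : (doubleDerivation D)^[i] P =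
      ∑ j, C (c j) * map C (D^[i] (monomial (mon j) 1)) := by
    induction i with
    | zero => exact Finset.sum_congr rfl fun j _ => monomial_eq_C_mul_map_C _ _
    | succ i ih =>
      rw [Function.iterate_succ_apply', ih, map_sum]
      exact Finset.sum_congr rfl fun j _ => by
        rw [doubleDerivation_C_mul_map_C, Function.iterate_succ_apply']
  have hPmem : P ∈ contactIdeal D := mem_contactIdeal_of_isHomogeneous hPhom fun i => by
    rw [hPit, map_sum, ← hc i]
    exact Finset.sum_congr rfl fun j _ => by rw [map_mul, eval_C, eval_X_map_C]
  obtain ⟨z, hzmem, hz⟩ := (contactIdeal_isPrime D).exists_mem_prime_of_ne_bot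
    fun h0 => hP0 (by rw [h0] at hPmem; exact hPmem)
  have hdvd {w} (hw : w ∈ contactIdeal D) : z ∣ w := by
    refine dvd_of_prime_of_mem (doubleDerivation D) (contactIdeal_isPrime D)
      (fun f => doubleDerivation_mem_contactIdeal hhom)
      (fun f => eulerDerivation_mem_contactIdeal)
      (fun s hs => by simpa using eval_X_eq_zero_of_mem_contactIdeal hs) ?_ hz hzmem hw
    intro j k hjk hmem
    have h0 := eval_X_eq_zero_of_mem_contactIdeal hmem
    simp only [doubleDerivation, mkDerivation_X, map_sub, map_mul, eval_X, eval_X_map_C] at h0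
    refine h1 ⟨X k, X j, isHomogeneous_X _ _, isHomogeneous_X _ _, ?_, by
      linear_combination h0⟩
    rw [LinearIndependent.pair_iff' (X_ne_zero k)]
    intro a ha
    have := congrArg (coeff (Finsupp.single j 1)) ha
    simp [coeff_X, hjk.symm, Finsupp.single_left_inj] at this
  obtain ⟨e, he⟩ := exists_isHomogeneous_of_dvd_eulerDerivation hz.ne_zero
    (hdvd (eulerDerivation_mem_contactIdeal hzmem))
  have hdiag := eval_X_eq_zero_of_mem_contactIdeal hzmem
  refine ⟨e, ?_, ?_, hasRatFirstIntegral_of_dvd hz.ne_zero hdiag he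
    (hdvd (doubleDerivation_mem_contactIdeal hhom hzmem))⟩
  · rw [Nat.one_le_iff_ne_zero]
    intro h0
    rw [← he.totalDegree hz.ne_zero, totalDegree_eq_zero_iff_eq_C] at h0
    rw [h0, eval_C] at hdiag
    exact hz.ne_zero (by rw [h0, hdiag, C_0])
  · obtain ⟨q, hq⟩ := hdvd hPmem
    rw [← hPhom.totalDegree hP0, ← he.totalDegree hz.ne_zero, hq,
      totalDegree_mul_of_isDomain hz.ne_zero (right_ne_zero_of_mul (hq ▸ hP0))]
    exact Nat.le_add_right _ _

lemma exists_equiv_degree_eq (n : ℕ) :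
    Nonempty (Fin ((n + 2).choose 2) ≃ {a : Fin 3 →₀ ℕ // a.degree = n}) := by
  have e1 : Sym (Fin 3) n ≃ {a : Fin 3 →₀ ℕ // a.degree = n} := Sym.equivNatSum (Fin 3) n
  have hcard : Fintype.card (Sym (Fin 3) n) = (n + 2).choose 2 := by
    rw [Sym.card_sym_eq_choose, Fintype.card_fin, show 3 + n - 1 = n + 2 by omega]
    exact Nat.choose_symm_add
  exact ⟨((Fintype.equivFinOfCardEq hcard).symm).trans e1⟩

section Extactic

variable {σ R : Type*} [CommRing R]

lemma MvPolynomial.IsHomogeneous.derivation_apply [Fintype σ]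
    {D : Derivation R (MvPolynomial σ R) (MvPolynomial σ R)} {m : ℕ}
    (hD : ∀ i, (D (X i)).IsHomogeneous (m + 1)) {f : MvPolynomial σ R} {d : ℕ}
    (hf : f.IsHomogeneous d) : (D f).IsHomogeneous (d + m) := by
  rw [derivation_eq_sum_pderiv]
  refine IsHomogeneous.sum _ _ _ fun l _ => ?_
  rcases d with _ | d
  · rw [totalDegree_eq_zero_iff_eq_C.1 (Nat.le_zero.1 hf.totalDegree_le), pderiv_C, zero_mul]
    exact isHomogeneous_zero _ _ _
  · convert hf.pderiv.mul (hD l) using 1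
    omega

lemma MvPolynomial.IsHomogeneous.derivation_iterate [Fintype σ]
    {D : Derivation R (MvPolynomial σ R) (MvPolynomial σ R)} {m : ℕ}
    (hD : ∀ i, (D (X i)).IsHomogeneous (m + 1)) {f : MvPolynomial σ R} {d : ℕ}
    (hf : f.IsHomogeneous d) (i : ℕ) : (D^[i] f).IsHomogeneous (d + i * m) := by
  induction i with
  | zero => simpa using hf
  | succ i ih =>
    rw [Function.iterate_succ_apply']
    convert ih.derivation_apply hD using 1
    ring

lemma MvPolynomial.IsHomogeneous.det {ι : Type*} [Fintype ι] [DecidableEq ι]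
    {M : Matrix ι ι (MvPolynomial σ R)} {d : ι → ℕ} (h : ∀ i j, (M i j).IsHomogeneous (d i)) :
    M.det.IsHomogeneous (∑ i, d i) := by
  rw [← Matrix.det_transpose, Matrix.det_apply]
  refine IsHomogeneous.sum _ _ _ fun s _ => ?_
  rw [Units.smul_def]
  have hs : ∏ i, M.transpose (s i) i ∈ homogeneousSubmodule σ R (∑ i, d i) :=
    IsHomogeneous.prod _ _ _ fun i _ => h _ _
  exact zsmul_mem hs _

lemma derivation_iterate_mem {A : Type*} [CommRing A] [Algebra R A] (D : Derivation R A A)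
    {I : Ideal A} (hI : ∀ f ∈ I, D f ∈ I) {f : A} (hf : f ∈ I) (i : ℕ) : D^[i] f ∈ I := by
  induction i with
  | zero => exact hf
  | succ i ih => rw [Function.iterate_succ_apply']; exact hI _ ih

/-- A prime ideal stable under a derivation `D` and containing a nontrivial linear combination
of the `v j` contains the Wronskian determinant of the `v j`. -/
lemma det_iterate_mem_of_sum_smul_mem {K A : Type*} [Field K] [CommRing A] [Algebra K A]
    (D : Derivation K A A) {I : Ideal A} [hprime : I.IsPrime] (hI : ∀ f ∈ I, D f ∈ I) {N : ℕ}
    (v : Fin N → A) {c : Fin N → K} (hc : c ≠ 0) (h : ∑ j, c j • v j ∈ I) :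
    (Matrix.of fun i j : Fin N => D^[(i : ℕ)] (v j)).det ∈ I := by
  rw [← Ideal.Quotient.eq_zero_iff_mem, RingHom.map_det, ← Matrix.exists_mulVec_eq_zero_iff]
  refine ⟨fun j => algebraMap K (A ⧸ I) (c j), fun h0 => hc ?_, ?_⟩
  · ext j
    exact (map_eq_zero_iff _ (algebraMap K (A ⧸ I)).injective).1 (congrFun h0 j)
  · ext i
    have h1 : D^[(i : ℕ)] (∑ j, c j • v j) = ∑ j, c j • D^[(i : ℕ)] (v j) := by
      generalize (i : ℕ) = i
      induction i with
      | zero => rfl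
      | succ i ih =>
        simp only [Function.iterate_succ_apply', ih, map_sum, Derivation.map_smul]
    have h2 := Ideal.Quotient.eq_zero_iff_mem.2 (derivation_iterate_mem D hI h i)
    rw [h1, map_sum] at h2
    rw [Pi.zero_apply, ← h2]
    simp only [Matrix.mulVec, dotProduct]
    refine Finset.sum_congr rfl fun j _ => ?_
    rw [Algebra.smul_def, map_mul, mul_comm]
    rfl

/-- An irreducible homogeneous invariant polynomial of degree at most `n` divides the extactic
determinant of order `n`. -/
lemma dvd_det_iterate_of_irreducible {K : Type*} [Field K] [Nonempty σ]
    (D : Derivation K (MvPolynomial σ K) (MvPolynomial σ K)) {n N : ℕ}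
    (mon : Fin N ≃ {a : σ →₀ ℕ // a.degree = n}) {F L : MvPolynomial σ K} {d : ℕ}
    (hF : Irreducible F) (hFd : F.IsHomogeneous d) (hd : d ≤ n) (hL : D F = L * F) :
    F ∣ (Matrix.of fun i j : Fin N => D^[(i : ℕ)] (monomial (mon j : σ →₀ ℕ) 1)).det := by
  classical
  obtain ⟨s⟩ := ‹Nonempty σ›
  rw [← Ideal.mem_span_singleton]
  have := (Ideal.span_singleton_prime hF.ne_zero).2 hF.prime
  set G := F * X s ^ (n - d) with hG
  have hG0 : G ≠ 0 := mul_ne_zero hF.ne_zero (pow_ne_zero _ (X_ne_zero s))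
  have hGhom : G.IsHomogeneous n := by
    convert hFd.mul (isHomogeneous_X_pow s (n - d)) using 1
    omega
  have hdeg (a) (ha : coeff a G ≠ 0) : a.degree = n := by
    rw [← hGhom ha]
    exact DFunLike.congr_fun Finsupp.degree_eq_weight_one a
  have hsum : ∑ j, coeff (mon j) G • monomial (mon j : σ →₀ ℕ) (1 : K) = G := by
    ext a
    simp only [coeff_sum, coeff_smul, coeff_monomial, smul_eq_mul, mul_ite, mul_one, mul_zero]
    by_cases ha : coeff a G = 0
    · rw [ha]
      exact Finset.sum_eq_zero fun j _ => ite_eq_right_iff.2 fun h => h ▸ ha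
    · rw [Finset.sum_eq_single (mon.symm ⟨a, hdeg a ha⟩)]
      · simp
      · intro j _ hj
        exact if_neg fun h => hj (by rw [Equiv.eq_symm_apply]; exact Subtype.ext h)
      · simp
  refine det_iterate_mem_of_sum_smul_mem D ?_ _ (c := fun j => coeff (mon j) G) ?_ ?_
  · intro f hf
    rw [Ideal.mem_span_singleton] at hf ⊢
    obtain ⟨q, rfl⟩ := hf
    rw [Derivation.leibniz, hL]
    exact dvd_add (dvd_mul_right _ _) ((dvd_mul_left _ _).mul_left _)
  · intro h0
    obtain ⟨a, ha⟩ := ne_zero_iff.1 hG0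
    have := congrFun h0 (mon.symm ⟨a, hdeg a ha⟩)
    simp only [Equiv.apply_symm_apply] at this
    exact ha this
  · rw [hsum, Ideal.mem_span_singleton]
    exact dvd_mul_right _ _

lemma exists_eq_smul_of_associated {K : Type*} [Field K] {f g : MvPolynomial σ K}
    (h : Associated f g) : ∃ c : K, f = c • g := by
  obtain ⟨u, hu⟩ := h.symm
  obtain ⟨c, -, hc⟩ := MvPolynomial.isUnit_iff_eq_C_of_isReduced.1 u.isUnit
  exact ⟨c, by rw [← hu, hc, smul_eq_C_mul, mul_comm]⟩

end Extactic

lemma sum_extactic_degree {m n N : ℕ} (hN : (n + 2).choose 2 = N) :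
    ∑ i : Fin N, (n + i * m) =
      ((m + 1) * (n ^ 4 + 6 * n ^ 3 + 11 * n ^ 2 + 6 * n) + n ^ 2 + 2 * n - n ^ 4 - 2 * n ^ 3)
        / 8 := by
  have h1 : 2 * N = (n + 2) * (n + 1) := by
    rw [← hN, Nat.choose_two_right, Nat.mul_div_cancel' (Nat.even_mul_pred_self _).two_dvd]
    rfl
  obtain ⟨N, rfl⟩ : ∃ N', N = N' + 1 := Nat.exists_eq_succ_of_ne_zero (by rintro rfl; simp at h1)
  have h2 : (∑ i ∈ Finset.range (N + 1), i) * 2 = (N + 1) * N := Finset.sum_range_id_mul_two _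
  rw [Fin.sum_univ_eq_sum_range (fun i => n + i * m), Finset.sum_add_distrib, Finset.sum_const,
    Finset.card_range, smul_eq_mul, ← Finset.sum_mul]
  symm
  apply Nat.div_eq_of_eq_mul_right (by norm_num)
  rw [Nat.sub_sub]
  apply Nat.sub_eq_of_eq_add
  zify at h1 h2 ⊢
  linear_combination (-4 * (m : ℤ)) * h2 - 4 * n * h1 - m * (2 * N + n ^ 2 + 3 * n + 2) * h1

/-- For a derivation `D = a·∂x + b·∂y + c·∂z` with `a,b,c` homogeneous of the same degree
`m ≥ 1` admitting no rational first integral of degree `≤ n`, the sum of the degrees of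
pairwise non-associated irreducible homogeneous invariant polynomials of degree `≤ n` is
at most `(m(n⁴+6n³+11n²+6n) − n⁴ − 2n³ + n² + 2n)/8`. -/
theorem extactic_stmt_6
    (D : Derivation ℂ (MvPolynomial (Fin 3) ℂ) (MvPolynomial (Fin 3) ℂ))
    (m : ℕ) (hm : 1 ≤ m)
    (hhom : ∀ i : Fin 3, (D (X i)).IsHomogeneous m)
    (n : ℕ) (hn : 1 ≤ n)
    (hnofi : ∀ e, 1 ≤ e → e ≤ n → ¬ HasRatFirstIntegral D e)
    (k : ℕ) (F : Fin k → MvPolynomial (Fin 3) ℂ) (deg : Fin k → ℕ)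
    (hirr : ∀ i, Irreducible (F i))
    (hFhom : ∀ i, (F i).IsHomogeneous (deg i))
    (hdegn : ∀ i, deg i ≤ n)
    (hinv : ∀ i, ∃ L : MvPolynomial (Fin 3) ℂ, D (F i) = L * F i)
    (hnonassoc : ∀ i j, i ≠ j → ∀ c : ℂ, F i ≠ c • F j) :
    ∑ i, deg i ≤
      (m * (n ^ 4 + 6 * n ^ 3 + 11 * n ^ 2 + 6 * n) + n ^ 2 + 2 * n - n ^ 4 - 2 * n ^ 3) / 8 := by
  obtain ⟨m, rfl⟩ := Nat.exists_eq_add_of_le' hm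
  obtain ⟨mon⟩ := exists_equiv_degree_eq n
  generalize hN : (n + 2).choose 2 = N at mon
  set M : Matrix _ _ (MvPolynomial (Fin 3) ℂ) := Matrix.of fun i j : Fin N =>
    D^[(i : ℕ)] (monomial (mon j : Fin 3 →₀ ℕ) 1)
  have hdet : M.det ≠ 0 := fun h => by
    obtain ⟨e, h1, h2, h3⟩ := exists_hasRatFirstIntegral_of_det_eq_zero D hhom hn
      (fun j => (mon j : Fin 3 →₀ ℕ)) (Subtype.val_injective.comp mon.injective)
      (fun j => (mon j).2) h
    exact hnofi e h1 h2 h3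
  have hMhom : M.det.IsHomogeneous (∑ i : Fin N, (n + i * m)) := IsHomogeneous.det fun i j =>
    IsHomogeneous.derivation_iterate hhom (isHomogeneous_monomial 1 (mon j).2) i
  have hdvd : ∏ i, F i ∣ M.det := by
    refine Fintype.prod_dvd_of_isRelPrime (fun i j hij => ?_) fun i => ?_
    · rw [Function.onFun, (hirr i).isRelPrime_iff_not_dvd]
      intro h
      obtain ⟨c, hc⟩ := exists_eq_smul_of_associated ((hirr i).associated_of_dvd (hirr j) h)
      exact hnonassoc i j hij c hc
    · obtain ⟨L, hL⟩ := hinv i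
      exact dvd_det_iterate_of_irreducible D mon (hirr i) (hFhom i) (hdegn i) hL
  have hprod : (∏ i, F i) ≠ 0 := Finset.prod_ne_zero_iff.2 fun i _ => (hirr i).ne_zero
  obtain ⟨q, hq⟩ := hdvd
  rw [← sum_extactic_degree hN, ← hMhom.totalDegree hdet,
    ← (IsHomogeneous.prod _ _ _ fun i _ => hFhom i).totalDegree hprod, hq,
    totalDegree_mul_of_isDomain hprod (right_ne_zero_of_mul (hq ▸ hdet))]
  exact Nat.le_add_right _ _
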